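/- arXiv:1904.10734 — 3 statements merged into one kernel-verified Lean document; each statement's English description precedes it below -/
import Mathlib

section
/- Let α ∈ (0,1) and let λ : [0,∞) → ℝ be a smooth compactly supported function with 0 ≤ λ ≤ 1. Then there is a constant C > 0 such that for all R ≥ 1, |∫₀^∞ w^{2α−2} λ(w/R) sin(w) dw| ≤ C, where for each R the integral converges (absolutely near 0, and as an improper/oscillatory integral at infinity it is in fact an integral over a compact interval since λ is compactly supported). -/
open MeasureTheory

/-- Integration by parts against `sin`: the truncated oscillatory integral with exponent `s < 0`
is bounded in terms of a derivative bound and the support of the cutoff only. -/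
lemma abs_integral_rpow_mul_cutoff_mul_sin_le {s : ℝ} (hs : s < 0) {lam : ℝ → ℝ}
    (hlam : ContDiff ℝ 1 lam) (hlam_abs : ∀ t, |lam t| ≤ 1) {K M : ℝ} (hM : 1 ≤ M)
    (hK : ∀ t, |deriv lam t| ≤ K) (hlamM : lam M = 0) {R : ℝ} (hR : 1 ≤ R) :
    |∫ w in (1 : ℝ)..(R * M), w ^ s * lam (w / R) * Real.sin w| ≤ 2 + K * M := by
  have hR0 : 0 < R := by linarith
  have hT : 1 ≤ R * M := one_le_mul_of_one_le_of_one_le hR hM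
  have hK0 : 0 ≤ K := (abs_nonneg _).trans (hK 0)
  have hpos : ∀ w ∈ Set.uIcc 1 (R * M), 0 < w := fun w hw ↦ by
    rw [Set.uIcc_of_le hT] at hw; linarith [hw.1]
  set u' : ℝ → ℝ := fun w ↦ s * w ^ (s - 1) * lam (w / R) + w ^ s * (deriv lam (w / R) * (1 / R))
  have hu : ∀ w ∈ Set.uIcc 1 (R * M), HasDerivAt (fun w ↦ w ^ s * lam (w / R)) (u' w) w := by
    intro w hw
    have h1 := Real.hasDerivAt_rpow_const (p := s) (Or.inl (hpos w hw).ne')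
    have h2 : HasDerivAt lam (deriv lam (w / R)) (w / R) :=
      (hlam.differentiable (by norm_num) _).hasDerivAt
    exact h1.mul (h2.comp w ((hasDerivAt_id w).div_const R))
  have hv : ∀ w ∈ Set.uIcc 1 (R * M), HasDerivAt (fun w ↦ -Real.cos w) (Real.sin w) w := by
    intro w _
    simpa using (Real.hasDerivAt_cos w).fun_neg
  have hrpow : ∀ p : ℝ, ContinuousOn (fun w : ℝ ↦ w ^ p) (Set.uIcc 1 (R * M)) := fun p ↦
    continuousOn_id.rpow_const fun w hw ↦ Or.inl (hpos w hw).ne'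
  have hlamc : Continuous fun w ↦ lam (w / R) :=
    hlam.continuous.comp (continuous_id.div_const R)
  have hdlamc : Continuous fun w ↦ deriv lam (w / R) :=
    (hlam.continuous_deriv le_rfl).comp (continuous_id.div_const R)
  have hu'int : IntervalIntegrable u' volume 1 (R * M) := by
    refine ContinuousOn.intervalIntegrable ?_
    exact ((continuousOn_const.mul (hrpow _)).mul hlamc.continuousOn).add
      ((hrpow _).mul (hdlamc.continuousOn.mul continuousOn_const))
  have hparts := intervalIntegral.integral_mul_deriv_eq_deriv_mul hu hv hu'int
    (Real.continuous_sin.intervalIntegrable _ _)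
  have hpowint : IntervalIntegrable (fun w : ℝ ↦ -s * w ^ (s - 1)) volume 1 (R * M) :=
    (continuousOn_const.mul (hrpow _)).intervalIntegrable
  have hbound : |∫ w in (1 : ℝ)..(R * M), u' w * -Real.cos w| ≤
      ∫ w in (1 : ℝ)..(R * M), (-s * w ^ (s - 1) + K / R) := by
    rw [← Real.norm_eq_abs]
    refine intervalIntegral.norm_integral_le_of_norm_le hT (.of_forall fun w hw ↦ ?_)
      (hpowint.add intervalIntegrable_const)
    have hw0 : 0 < w := by linarith [hw.1]
    have hp0 : 0 ≤ w ^ (s - 1) := Real.rpow_nonneg hw0.le _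
    have hps : 0 ≤ w ^ s := Real.rpow_nonneg hw0.le _
    have hps1 : w ^ s ≤ 1 := Real.rpow_le_one_of_one_le_of_nonpos hw.1.le hs.le
    have e1 : |s * w ^ (s - 1) * lam (w / R)| ≤ -s * w ^ (s - 1) := by
      rw [abs_mul, abs_mul, abs_of_neg hs, abs_of_nonneg hp0]
      exact mul_le_of_le_one_right (mul_nonneg (by linarith) hp0) (hlam_abs _)
    have e2 : |w ^ s * (deriv lam (w / R) * (1 / R))| ≤ K / R := by
      rw [abs_mul, abs_mul, abs_of_nonneg hps, abs_of_pos (one_div_pos.2 hR0), div_eq_mul_one_div K]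
      have := mul_le_mul_of_nonneg_right (hK (w / R)) (one_div_pos.2 hR0).le
      exact (mul_le_of_le_one_left (by positivity) hps1).trans this
    rw [Real.norm_eq_abs, abs_mul, abs_neg]
    exact (mul_le_of_le_one_right (abs_nonneg _) (Real.abs_cos_le_one w)).trans
      ((abs_add_le _ _).trans (add_le_add e1 e2))
  have hval : ∫ w in (1 : ℝ)..(R * M), (-s * w ^ (s - 1) + K / R) ≤ 1 + K * M := by
    rw [intervalIntegral.integral_add hpowint intervalIntegrable_const,
      intervalIntegral.integral_const_mul, integral_rpow, intervalIntegral.integral_const]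
    · rw [sub_add_cancel, Real.one_rpow, smul_eq_mul]
      have h1 : -s * (((R * M) ^ s - 1) / s) = 1 - (R * M) ^ s := by
        field_simp [hs.ne]; ring
      have h2 : (R * M - 1) * (K / R) = K * M - K / R := by field_simp
      have h3 : 0 ≤ K / R := by positivity
      have h4 : 0 ≤ (R * M) ^ s := Real.rpow_nonneg (by linarith) _
      rw [h1, h2]; linarith
    · refine Or.inr ⟨by linarith, fun h ↦ (hpos 0 h).ne' rfl⟩
  have hend : lam (R * M / R) = 0 := by rwa [mul_div_cancel_left₀ _ hR0.ne']
  have hstart : |lam (1 / R) * Real.cos 1| ≤ 1 := by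
    rw [abs_mul]
    exact mul_le_one₀ (hlam_abs _) (abs_nonneg _) (Real.abs_cos_le_one 1)
  rw [hparts, hend, Real.one_rpow]
  have hsplit : (R * M) ^ s * 0 * -Real.cos (R * M) - 1 * lam (1 / R) * -Real.cos 1 -
      ∫ w in (1 : ℝ)..(R * M), u' w * -Real.cos w =
      lam (1 / R) * Real.cos 1 - ∫ w in (1 : ℝ)..(R * M), u' w * -Real.cos w := by ring
  rw [hsplit]
  have := abs_sub (lam (1 / R) * Real.cos 1) (∫ w in (1 : ℝ)..(R * M), u' w * -Real.cos w)
  linarith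

/-- For `α ∈ (0,1)` and a smooth compactly supported cutoff `λ` with
`0 ≤ λ ≤ 1`, there is `C > 0` such that for all `R ≥ 1`,
`|∫₀^∞ w^{2α-2} λ(w/R) sin w dw| ≤ C`, the integral converging absolutely. -/
theorem stmt1
    (α : ℝ) (hα : α ∈ Set.Ioo (0 : ℝ) 1)
    (lam : ℝ → ℝ) (hlam_smooth : ContDiff ℝ (⊤ : ℕ∞) lam)
    (hlam_supp : HasCompactSupport lam)
    (hlam_nonneg : ∀ t, 0 ≤ lam t) (hlam_le : ∀ t, lam t ≤ 1) :
    ∃ C : ℝ, 0 < C ∧ ∀ R : ℝ, 1 ≤ R →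
      IntegrableOn (fun w : ℝ => w ^ (2 * α - 2) * lam (w / R) * Real.sin w)
        (Set.Ioi 0) ∧
      |∫ w in Set.Ioi (0 : ℝ), w ^ (2 * α - 2) * lam (w / R) * Real.sin w| ≤ C := by
  obtain ⟨hα0, hα1⟩ := hα
  have hlam1 : ContDiff ℝ 1 lam := hlam_smooth.of_le (by exact_mod_cast le_top)
  have hlam_abs : ∀ t, |lam t| ≤ 1 := fun t ↦ by
    rw [abs_of_nonneg (hlam_nonneg t)]; exact hlam_le t
  obtain ⟨K, hK⟩ := hlam_supp.deriv.exists_bound_of_continuous (hlam1.continuous_deriv le_rfl)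
  obtain ⟨M, hM, hlamM⟩ : ∃ M : ℝ, 1 ≤ M ∧ ∀ t, M ≤ t → lam t = 0 := by
    obtain ⟨B, hB⟩ := hlam_supp.isCompact.isBounded.bddAbove
    refine ⟨max 1 (B + 1), le_max_left _ _, fun t ht ↦ image_eq_zero_of_notMem_tsupport fun h ↦ ?_⟩
    linarith [hB h, (le_max_right 1 (B + 1)).trans ht]
  have hK0 : 0 ≤ K := (norm_nonneg _).trans (hK 0)
  refine ⟨1 / (2 * α) + (2 + K * M), by positivity, fun R hR ↦ ?_⟩
  have hR0 : 0 < R := by linarith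
  have hT : 1 ≤ R * M := one_le_mul_of_one_le_of_one_le hR hM
  set f : ℝ → ℝ := fun w ↦ w ^ (2 * α - 2) * lam (w / R) * Real.sin w
  have hf : ContinuousOn f (Set.Ioi 0) :=
    ((continuousOn_id.rpow_const fun w hw ↦ Or.inl (ne_of_gt hw)).mul
      (hlam1.continuous.comp (continuous_id.div_const R)).continuousOn).mul
      Real.continuous_sin.continuousOn
  have hnear : ∀ w ∈ Set.Ioc (0 : ℝ) 1, ‖f w‖ ≤ w ^ (2 * α - 1) := by
    intro w hw
    have hp : 0 ≤ w ^ (2 * α - 2) := Real.rpow_nonneg hw.1.le _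
    have hsin : |Real.sin w| ≤ w := Real.abs_sin_le_abs.trans_eq (abs_of_pos hw.1)
    have hpow : w ^ (2 * α - 1) = w ^ (2 * α - 2) * w := by
      rw [← Real.rpow_add_one hw.1.ne']; ring_nf
    rw [Real.norm_eq_abs, abs_mul, abs_mul, abs_of_nonneg hp, hpow]
    exact mul_le_mul (mul_le_of_le_one_right hp (hlam_abs _)) hsin (abs_nonneg _) hp
  have hgint : IntervalIntegrable (fun w : ℝ ↦ w ^ (2 * α - 1)) volume 0 1 :=
    intervalIntegral.intervalIntegrable_rpow' (by linarith)
  have hint1 : IntegrableOn f (Set.Ioc 0 1) :=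
    Integrable.mono' ((intervalIntegrable_iff_integrableOn_Ioc_of_le zero_le_one).1 hgint)
      ((hf.mono fun w hw ↦ hw.1).aestronglyMeasurable measurableSet_Ioc)
      (ae_restrict_of_forall_mem measurableSet_Ioc hnear)
  have hint2 : IntegrableOn f (Set.Ioc 1 (R * M)) :=
    ((hf.mono fun w hw ↦ zero_lt_one.trans_le hw.1).integrableOn_compact
      isCompact_Icc).mono_set Set.Ioc_subset_Icc_self
  have hfar : ∀ w ∈ Set.Ioi (R * M), f w = 0 := fun w hw ↦ by
    have : lam (w / R) = 0 := hlamM _ ((le_div_iff₀' hR0).2 (le_of_lt hw))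
    simp [f, this]
  have hint3 : IntegrableOn f (Set.Ioi (R * M)) :=
    integrableOn_zero.congr_fun (fun w hw ↦ (hfar w hw).symm) measurableSet_Ioi
  have hint23 : IntegrableOn f (Set.Ioi 1) := by
    rw [← Set.Ioc_union_Ioi_eq_Ioi hT]; exact hint2.union hint3
  have hint : IntegrableOn f (Set.Ioi 0) := by
    rw [← Set.Ioc_union_Ioi_eq_Ioi zero_le_one]; exact hint1.union hint23
  refine ⟨hint, ?_⟩
  have hbound1 : |∫ w in (0 : ℝ)..1, f w| ≤ 1 / (2 * α) := by
    have hle := intervalIntegral.norm_integral_le_of_norm_le zero_le_one (.of_forall hnear) hgint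
    rw [integral_rpow (Or.inl (by linarith)), sub_add_cancel, Real.one_rpow,
      Real.zero_rpow (by positivity), sub_zero] at hle
    exact hle
  have hbound2 : |∫ w in (1 : ℝ)..(R * M), f w| ≤ 2 + K * M :=
    abs_integral_rpow_mul_cutoff_mul_sin_le (by linarith) hlam1 hlam_abs hM hK (hlamM M le_rfl) hR
  have hsplit : ∫ w in Set.Ioi (0 : ℝ), f w =
      (∫ w in (0 : ℝ)..1, f w) + ∫ w in (1 : ℝ)..(R * M), f w := by
    rw [← intervalIntegral.integral_interval_add_Ioi hint hint23,
      ← intervalIntegral.integral_interval_add_Ioi hint23 hint3,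
      setIntegral_eq_zero_of_forall_eq_zero hfar, add_zero]
  rw [hsplit]
  exact (abs_add_le _ _).trans (add_le_add hbound1 hbound2)
end

section
/- Let d ∈ {2,3}, α ∈ (1/2, 1), let Γ ⊂ ℝ^d be a nonempty compact set, and let x ∈ ℝ^d with dist(x, Γ) > 0; set r* = dist(x, Γ)/2. Then for every fixed r ∈ (0, r*] there is a constant K (depending on x, Γ, α, r but not on y) such that for all y ∈ Γ, ∫_{{z ∈ ℝ^d : |z| ≥ r}} | |x+z−y|^{2α−d} − |x−y|^{2α−d} | / |z|^{d+2α} dz ≤ K; in particular this integral is finite for every y ∈ Γ. -/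
open MeasureTheory

section RieszKernel

variable {E : Type*} [NormedAddCommGroup E]

/-- The part of the Riesz kernel `‖u‖ ^ p` living in the unit ball. -/
noncomputable def truncatedKernel (p : ℝ) : E → ℝ :=
  (Metric.ball (0 : E) 1).indicator fun u => ‖u‖ ^ p

lemma truncatedKernel_nonneg (p : ℝ) (u : E) : 0 ≤ truncatedKernel p u :=
  Set.indicator_nonneg (fun _ _ => by positivity) u

lemma norm_rpow_le_truncatedKernel_add_one {p : ℝ} (hp : p ≤ 0) (u : E) :
    ‖u‖ ^ p ≤ truncatedKernel p u + 1 := by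
  by_cases h : u ∈ Metric.ball (0 : E) 1
  · simp [truncatedKernel, h]
  · rw [truncatedKernel, Set.indicator_of_notMem h, zero_add]
    exact Real.rpow_le_one_of_one_le_of_nonpos (by simpa using h) hp

lemma integrable_truncatedKernel [NormedSpace ℝ E] [FiniteDimensional ℝ E] [Nontrivial E]
    [MeasurableSpace E] [BorelSpace E] (μ : Measure E) [μ.IsAddHaarMeasure] {p : ℝ}
    (hp : -(Module.finrank ℝ E : ℝ) < p) : Integrable (truncatedKernel p : E → ℝ) μ := by
  rw [truncatedKernel, integrable_indicator_iff measurableSet_ball,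
    integrableOn_fun_norm_addHaar μ (f := fun t : ℝ => t ^ p)]
  have hdim : 1 ≤ Module.finrank ℝ E := Module.finrank_pos
  have h : IntegrableOn (fun t : ℝ => t ^ ((Module.finrank ℝ E : ℝ) - 1 + p)) (Set.Ioo 0 1) :=
    (intervalIntegral.integrableOn_Ioo_rpow_iff one_pos).2 (by linarith)
  refine h.congr_fun (fun t ht => ?_) measurableSet_Ioo
  simp only [smul_eq_mul]
  rw [Real.rpow_add ht.1, ← Real.rpow_natCast, Nat.cast_sub hdim, Nat.cast_one]

lemma norm_rpow_neg_le_one_add_norm {q r : ℝ} (hq : 0 ≤ q) (hr : 0 < r) {z : E} (hz : r ≤ ‖z‖) :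
    (‖z‖ ^ q)⁻¹ ≤ (1 / r + 1) ^ q * (1 + ‖z‖) ^ (-q) := by
  have hz0 : 0 < ‖z‖ := hr.trans_le hz
  have h1 : 1 + ‖z‖ ≤ (1 / r + 1) * ‖z‖ := by
    have : 1 ≤ 1 / r * ‖z‖ := by rw [one_div_mul_eq_div]; exact (one_le_div hr).2 hz
    linarith
  have h2 : (1 + ‖z‖) ^ q ≤ (1 / r + 1) ^ q * ‖z‖ ^ q := by
    rw [← Real.mul_rpow (by positivity) hz0.le]
    exact Real.rpow_le_rpow (by positivity) h1 hq
  rw [Real.rpow_neg (by positivity), ← div_eq_mul_inv, inv_eq_one_div,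
    div_le_div_iff₀ (by positivity) (by positivity), one_mul]
  exact h2

/-- Away from the origin the nonlocal difference quotient of the Riesz kernel is dominated by the
translated kernel near its singularity plus a tail that is uniform in `w`. -/
lemma abs_norm_rpow_sub_div_le {p q r D : ℝ} (hp : p ≤ 0) (hq : 0 ≤ q) (hr : 0 < r) (hD : 0 < D)
    {w z : E} (hw : D ≤ ‖w‖) (hz : r ≤ ‖z‖) :
    |‖z + w‖ ^ p - ‖w‖ ^ p| / ‖z‖ ^ q ≤
      (r ^ q)⁻¹ * truncatedKernel p (z + w) +
        (1 + D ^ p) * (1 / r + 1) ^ q * (1 + ‖z‖) ^ (-q) := by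
  have hg := truncatedKernel_nonneg p (z + w)
  have hwD : ‖w‖ ^ p ≤ D ^ p := Real.rpow_le_rpow_of_nonpos hD hw hp
  have hnum : |‖z + w‖ ^ p - ‖w‖ ^ p| ≤ truncatedKernel p (z + w) + (1 + D ^ p) := by
    have := norm_rpow_le_truncatedKernel_add_one hp (z + w)
    have h1 : 0 ≤ ‖z + w‖ ^ p := by positivity
    have h2 : 0 ≤ ‖w‖ ^ p := by positivity
    rw [abs_le]
    constructor <;> linarith
  have hzr : (‖z‖ ^ q)⁻¹ ≤ (r ^ q)⁻¹ :=
    inv_anti₀ (by positivity) (Real.rpow_le_rpow hr.le hz hq)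
  calc |‖z + w‖ ^ p - ‖w‖ ^ p| / ‖z‖ ^ q
      ≤ (truncatedKernel p (z + w) + (1 + D ^ p)) * (‖z‖ ^ q)⁻¹ := by
        rw [div_eq_mul_inv]; gcongr
    _ = (‖z‖ ^ q)⁻¹ * truncatedKernel p (z + w) + (1 + D ^ p) * (‖z‖ ^ q)⁻¹ := by ring
    _ ≤ _ := by
        rw [mul_assoc]
        gcongr
        exact norm_rpow_neg_le_one_add_norm hq hr hz

end RieszKernel

/-- For `d ∈ {2,3}`, `α ∈ (1/2,1)`, a nonempty compact `Γ ⊆ ℝ^d` and a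
point `x` with `dist(x,Γ) > 0`, setting `r* = dist(x,Γ)/2`, for every fixed `r ∈ (0, r*]`
there is a constant `K` such that for all `y ∈ Γ`,
`∫_{|z| ≥ r} ||x+z-y|^{2α-d} - |x-y|^{2α-d}| / |z|^{d+2α} dz ≤ K`,
the integral being finite. -/
theorem stmt7
    (d : ℕ) (hd : d = 2 ∨ d = 3)
    (α : ℝ) (hα : α ∈ Set.Ioo (1/2 : ℝ) 1)
    (Γ : Set (EuclideanSpace ℝ (Fin d))) (hΓc : IsCompact Γ) (hΓne : Γ.Nonempty)
    (x : EuclideanSpace ℝ (Fin d)) (hx : 0 < Metric.infDist x Γ) :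
    ∀ r ∈ Set.Ioc (0 : ℝ) (Metric.infDist x Γ / 2),
      ∃ K : ℝ, ∀ y ∈ Γ,
        IntegrableOn
          (fun z : EuclideanSpace ℝ (Fin d) =>
            |‖x + z - y‖ ^ (2 * α - (d : ℝ)) - ‖x - y‖ ^ (2 * α - (d : ℝ))| /
              ‖z‖ ^ ((d : ℝ) + 2 * α))
          {z : EuclideanSpace ℝ (Fin d) | r ≤ ‖z‖} ∧
        (∫ z in {z : EuclideanSpace ℝ (Fin d) | r ≤ ‖z‖},
            |‖x + z - y‖ ^ (2 * α - (d : ℝ)) - ‖x - y‖ ^ (2 * α - (d : ℝ))| /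
              ‖z‖ ^ ((d : ℝ) + 2 * α)) ≤ K := by
  rintro r ⟨hr, -⟩
  obtain ⟨hα₁, hα₂⟩ := hα
  have hd2 : (2 : ℝ) ≤ d := by rcases hd with rfl | rfl <;> norm_num
  have : Nontrivial (EuclideanSpace ℝ (Fin d)) :=
    Module.nontrivial_of_finrank_pos (R := ℝ) (by
      rw [finrank_euclideanSpace_fin]
      rcases hd with rfl | rfl <;> norm_num)
  set p : ℝ := 2 * α - d with hp_def
  set q : ℝ := d + 2 * α with hq_def
  set D := Metric.infDist x Γ
  have hp : p ≤ 0 := by linarith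
  have hq : 0 ≤ q := by linarith
  have hg : Integrable (truncatedKernel p : EuclideanSpace ℝ (Fin d) → ℝ) :=
    integrable_truncatedKernel _ (by rw [finrank_euclideanSpace_fin]; linarith)
  have ht : Integrable fun z : EuclideanSpace ℝ (Fin d) =>
      (1 + D ^ p) * (1 / r + 1) ^ q * (1 + ‖z‖) ^ (-q) :=
    (integrable_one_add_norm (by rw [finrank_euclideanSpace_fin]; linarith)).const_mul _
  have hmeas : MeasurableSet {z : EuclideanSpace ℝ (Fin d) | r ≤ ‖z‖} :=
    measurableSet_le measurable_const measurable_norm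
  refine ⟨(r ^ q)⁻¹ * (∫ u : EuclideanSpace ℝ (Fin d), truncatedKernel p u) +
    ∫ z : EuclideanSpace ℝ (Fin d), (1 + D ^ p) * (1 / r + 1) ^ q * (1 + ‖z‖) ^ (-q),
    fun y hy => ?_⟩
  have hw : D ≤ ‖x - y‖ := by
    rw [← dist_eq_norm]
    exact Metric.infDist_le_dist_of_mem hy
  have hgy := (hg.comp_add_right (x - y)).const_mul (r ^ q)⁻¹
  have hG := hgy.add ht
  have hbound : ∀ z ∈ {z : EuclideanSpace ℝ (Fin d) | r ≤ ‖z‖},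
      |‖x + z - y‖ ^ p - ‖x - y‖ ^ p| / ‖z‖ ^ q ≤
        (r ^ q)⁻¹ * truncatedKernel p (z + (x - y)) +
          (1 + D ^ p) * (1 / r + 1) ^ q * (1 + ‖z‖) ^ (-q) := by
    intro z hz
    rw [show x + z - y = z + (x - y) by abel]
    exact abs_norm_rpow_sub_div_le hp hq hr hx hw hz
  have hint : IntegrableOn (fun z : EuclideanSpace ℝ (Fin d) =>
      |‖x + z - y‖ ^ p - ‖x - y‖ ^ p| / ‖z‖ ^ q) {z | r ≤ ‖z‖} := by
    refine Integrable.mono' hG.integrableOn ?_ ?_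
    · exact Measurable.aestronglyMeasurable (by fun_prop)
    · refine (ae_restrict_iff' hmeas).2 (.of_forall fun z hz => ?_)
      rw [Real.norm_of_nonneg (by positivity)]
      exact hbound z hz
  refine ⟨hint, (setIntegral_mono_on hint hG.integrableOn hmeas hbound).trans ?_⟩
  refine (setIntegral_le_integral hG (.of_forall fun z => ?_)).trans_eq ?_
  · have := truncatedKernel_nonneg p (z + (x - y))
    simp only [Pi.add_apply, Pi.zero_apply]
    positivity
  · rw [integral_add' hgy ht, integral_const_mul,
      integral_add_right_eq_self (truncatedKernel p) (x - y)]
end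

section
/- Let d ∈ {2,3}, α ∈ (1/2, 1), let Γ ⊂ ℝ^d be a nonempty compact set, and let x ∈ ℝ^d with dist(x, Γ) > 0; set r* = dist(x, Γ)/2. Then there is a constant K̃ (depending on x, Γ, α but not on y or r) such that for all y ∈ Γ and all r ∈ (0, r*], the truncated integral ∫_{{z ∈ ℝ^d : |z| ≥ r}} ( |x+z−y|^{2α−d} − |x−y|^{2α−d} ) / |z|^{d+2α} dz converges absolutely and satisfies | ∫_{{z : |z| ≥ r}} ( |x+z−y|^{2α−d} − |x−y|^{2α−d} ) / |z|^{d+2α} dz | ≤ K̃. -/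
open MeasureTheory

/-- First-order Taylor estimate for a real power, uniform on `[m, ∞)`. -/
lemma abs_rpow_sub_rpow_sub_le {m γ : ℝ} (hm : 0 < m) (hγ : γ < 0) {s t : ℝ}
    (hs : m ≤ s) (ht : m ≤ t) :
    |s ^ γ - t ^ γ - γ * t ^ (γ - 1) * (s - t)| ≤
      |γ| * (|γ - 1| * m ^ (γ - 2)) * (s - t) ^ 2 := by
  have lip : ∀ u ∈ Set.Ici m, |u ^ (γ - 1) - t ^ (γ - 1)| ≤
      |γ - 1| * m ^ (γ - 2) * |u - t| := by
    intro u hu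
    have := Convex.norm_image_sub_le_of_norm_hasDerivWithin_le
      (f := fun u : ℝ => u ^ (γ - 1)) (f' := fun u : ℝ => (γ - 1) * u ^ (γ - 1 - 1))
      (s := Set.Ici m) (C := |γ - 1| * m ^ (γ - 2)) (x := t) (y := u)
      (fun v hv => (Real.hasDerivAt_rpow_const
        (Or.inl (hm.trans_le hv).ne')).hasDerivWithinAt)
      (fun v hv => by
        have hv0 : 0 < v := hm.trans_le hv
        rw [norm_mul, Real.norm_eq_abs, Real.norm_eq_abs, abs_of_pos (Real.rpow_pos_of_pos hv0 _),
          show γ - 1 - 1 = γ - 2 by ring]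
        exact mul_le_mul_of_nonneg_left
          (Real.rpow_le_rpow_of_nonpos hm hv (by linarith)) (abs_nonneg _))
      (convex_Ici m) ht hu
    simpa only [Real.norm_eq_abs] using this
  have hsub : Set.uIcc t s ⊆ Set.Ici m := fun v hv => (le_inf ht hs).trans hv.1
  have key := Convex.norm_image_sub_le_of_norm_hasDerivWithin_le
    (f := fun u : ℝ => u ^ γ - γ * t ^ (γ - 1) * u)
    (f' := fun u : ℝ => γ * u ^ (γ - 1) - γ * t ^ (γ - 1) * 1)
    (s := Set.uIcc t s) (C := |γ| * (|γ - 1| * m ^ (γ - 2) * |s - t|)) (x := t) (y := s)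
    (fun v hv => ((Real.hasDerivAt_rpow_const
        (Or.inl (hm.trans_le (hsub hv)).ne')).sub
        ((hasDerivAt_id v).const_mul _)).hasDerivWithinAt)
    (fun v hv => by
      rw [mul_one, ← mul_sub, norm_mul, Real.norm_eq_abs, Real.norm_eq_abs]
      refine mul_le_mul_of_nonneg_left ((lip v (hsub hv)).trans ?_) (abs_nonneg _)
      exact mul_le_mul_of_nonneg_left (Set.abs_sub_left_of_mem_uIcc hv) (by positivity))
    (convex_uIcc t s) Set.left_mem_uIcc Set.right_mem_uIcc
  rw [Real.norm_eq_abs, Real.norm_eq_abs] at key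
  calc _ = |s ^ γ - γ * t ^ (γ - 1) * s - (t ^ γ - γ * t ^ (γ - 1) * t)| := by
        congr 1; ring
    _ ≤ _ := key
    _ = _ := by rw [← sq_abs (s - t)]; ring

lemma sq_norm_rpow_half {E : Type*} [NormedAddCommGroup E] (w : E) (β : ℝ) : (‖w‖ ^ 2) ^ (β / 2) = ‖w‖ ^ β := by
  rw [← Real.rpow_natCast, ← Real.rpow_mul (norm_nonneg _)]
  congr 1; push_cast; ring

/-- An odd function has vanishing integral. -/
lemma integral_eq_zero_of_odd {E : Type*} [NormedAddCommGroup E] [MeasurableSpace E]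
    [BorelSpace E] (μ : Measure E) [μ.IsNegInvariant] {g : E → ℝ}
    (hg : ∀ z, g (-z) = -g z) : ∫ z, g z ∂μ = 0 := by
  have := integral_neg_eq_self g μ
  simp only [hg, integral_neg] at this
  linarith

section

variable {E : Type*} [NormedAddCommGroup E] [InnerProductSpace ℝ E]

/-- Linearization of `w ↦ ‖w‖ ^ β` at `a`, with a quadratic error uniform in `a`. -/
lemma abs_norm_add_rpow_sub_le {R M β : ℝ} (hR : 0 < R) (hβ : β < 0) {a z : E}
    (ha : 2 * R ≤ ‖a‖) (haM : ‖a‖ ≤ M) (hz : ‖z‖ ≤ R) :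
    |‖a + z‖ ^ β - ‖a‖ ^ β - β / 2 * (‖a‖ ^ 2) ^ (β / 2 - 1) * (2 * inner ℝ a z)| ≤
      (|β / 2| * (|β / 2 - 1| * (R ^ 2) ^ (β / 2 - 2)) * (2 * M + R) ^ 2 +
        |β / 2| * (R ^ 2) ^ (β / 2 - 1)) * ‖z‖ ^ 2 := by
  have haz : R ≤ ‖a + z‖ := by
    have := norm_sub_le (a + z) z
    rw [add_sub_cancel_right] at this
    linarith
  have h1 : R ^ 2 ≤ ‖a + z‖ ^ 2 := by gcongr
  have h2 : R ^ 2 ≤ ‖a‖ ^ 2 := by gcongr; linarith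
  have T := abs_rpow_sub_rpow_sub_le (γ := β / 2) (by positivity) (by linarith) h1 h2
  have hu : ‖a + z‖ ^ 2 - ‖a‖ ^ 2 = 2 * inner ℝ a z + ‖z‖ ^ 2 := by
    rw [norm_add_sq_real]; ring
  rw [sq_norm_rpow_half, sq_norm_rpow_half, hu] at T
  have hin := abs_real_inner_le_norm a z
  have hu2 : (2 * inner ℝ a z + ‖z‖ ^ 2) ^ 2 ≤ (2 * M + R) ^ 2 * ‖z‖ ^ 2 := by
    rw [← mul_pow, ← sq_abs]
    gcongr
    calc |2 * inner ℝ a z + ‖z‖ ^ 2| ≤ |2 * inner ℝ a z| + |‖z‖ ^ 2| := abs_add_le _ _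
      _ ≤ 2 * (‖a‖ * ‖z‖) + ‖z‖ * ‖z‖ := by
        rw [abs_mul, abs_two, abs_of_nonneg (sq_nonneg ‖z‖), sq]; gcongr
      _ ≤ 2 * (M * ‖z‖) + R * ‖z‖ := by gcongr
      _ = _ := by ring
  have hd : (‖a‖ ^ 2) ^ (β / 2 - 1) ≤ (R ^ 2) ^ (β / 2 - 1) :=
    Real.rpow_le_rpow_of_nonpos (by positivity) h2 (by linarith)
  calc _ = |(‖a + z‖ ^ β - ‖a‖ ^ β -
          β / 2 * (‖a‖ ^ 2) ^ (β / 2 - 1) * (2 * inner ℝ a z + ‖z‖ ^ 2)) +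
          β / 2 * (‖a‖ ^ 2) ^ (β / 2 - 1) * ‖z‖ ^ 2| := by congr 1; ring
    _ ≤ _ := abs_add_le _ _
    _ ≤ |β / 2| * (|β / 2 - 1| * (R ^ 2) ^ (β / 2 - 2)) * ((2 * M + R) ^ 2 * ‖z‖ ^ 2) +
        |β / 2| * (R ^ 2) ^ (β / 2 - 1) * ‖z‖ ^ 2 := by
      refine add_le_add (T.trans (by gcongr)) ?_
      rw [abs_mul, abs_mul, abs_of_nonneg (sq_nonneg ‖z‖),
        abs_of_nonneg (Real.rpow_nonneg (sq_nonneg ‖a‖) _)]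
      gcongr
    _ = _ := by ring

variable [FiniteDimensional ℝ E] [MeasurableSpace E] [BorelSpace E]

lemma integrable_indicator_ball_norm_rpow
    (μ : Measure E) [μ.IsAddHaarMeasure]
    (hE : 1 ≤ Module.finrank ℝ E) {s : ℝ} (hs : -(Module.finrank ℝ E : ℝ) < s) (R : ℝ) :
    Integrable ((Metric.ball (0 : E) R).indicator fun z => ‖z‖ ^ s) μ := by
  rw [integrable_indicator_iff measurableSet_ball]
  refine integrableOn_ball_of_norm_le_rpow hE (C := 1) (α := -s) (by linarith)
    (Filter.Eventually.of_forall fun z => ?_) (measurable_norm.pow_const s).aestronglyMeasurable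
  rw [Real.norm_of_nonneg (by positivity), neg_neg, one_mul]

/-- The part of the integral near infinity. -/
lemma integrable_indicator_compl_ball_norm_rpow
    (μ : Measure E) [μ.IsAddHaarMeasure]
    {p R : ℝ} (hp : (Module.finrank ℝ E : ℝ) < p) (hR : 0 < R) :
    Integrable ((Metric.ball (0 : E) R)ᶜ.indicator fun z => ‖z‖ ^ (-p)) μ := by
  have hp0 : 0 < p := lt_of_le_of_lt (Nat.cast_nonneg _) hp
  refine ((integrable_one_add_norm hp).const_mul ((R / (1 + R)) ^ (-p))).mono'
    ((measurable_norm.pow_const _).indicator measurableSet_ball.compl).aestronglyMeasurable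
    (Filter.Eventually.of_forall fun z => ?_)
  rw [norm_indicator_eq_indicator_norm]
  refine Set.indicator_apply_le' (fun hz => ?_) (fun _ => by positivity)
  have hz' : R ≤ ‖z‖ := by simpa using hz
  rw [Real.norm_of_nonneg (by positivity), ← Real.mul_rpow (by positivity) (by positivity)]
  refine Real.rpow_le_rpow_of_nonpos (by positivity) ?_ (by linarith)
  rw [div_mul_eq_mul_div, div_le_iff₀ (by positivity)]
  nlinarith

/-- Uniform bound on the truncated singular integral defining the fractional Laplacian of
`‖·‖ ^ β` at points `a` of an annulus. -/
lemma exists_bound_truncated_integral (μ : Measure E) [μ.IsAddHaarMeasure]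
    (hE : 1 ≤ Module.finrank ℝ E) {β p R M : ℝ} (hβ : β < 0)
    (hβE : -(Module.finrank ℝ E : ℝ) < β) (hp : (Module.finrank ℝ E : ℝ) < p)
    (hp2 : p < Module.finrank ℝ E + 2) (hR : 0 < R) :
    ∃ K : ℝ, ∀ a : E, 2 * R ≤ ‖a‖ → ‖a‖ ≤ M → ∀ r ∈ Set.Ioc 0 R,
      IntegrableOn (fun z => (‖a + z‖ ^ β - ‖a‖ ^ β) / ‖z‖ ^ p) {z | r ≤ ‖z‖} μ ∧
      |∫ z in {z | r ≤ ‖z‖}, (‖a + z‖ ^ β - ‖a‖ ^ β) / ‖z‖ ^ p ∂μ| ≤ K := by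
  set C : ℝ := |β / 2| * (|β / 2 - 1| * (R ^ 2) ^ (β / 2 - 2)) * (2 * M + R) ^ 2 +
        |β / 2| * (R ^ 2) ^ (β / 2 - 1) with hC
  have hC0 : 0 ≤ C := by positivity
  set B : Set E := Metric.ball 0 R with hB
  let G₁ : E → ℝ := fun z => C * B.indicator (fun z => ‖z‖ ^ (2 - p)) z +
    2 * R ^ β * Bᶜ.indicator (fun z => ‖z‖ ^ (-p)) z
  let G₂ : E → ℝ := fun z => R ^ (-p) * B.indicator (fun z => ‖z‖ ^ β) z
  have hG₁ : Integrable G₁ μ :=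
    ((integrable_indicator_ball_norm_rpow μ hE (by linarith) R).const_mul C).add
      ((integrable_indicator_compl_ball_norm_rpow μ hp hR).const_mul _)
  have hG₂ : Integrable G₂ μ :=
    (integrable_indicator_ball_norm_rpow μ hE hβE R).const_mul _
  have hi : ∀ (S : Set E) (s : ℝ) (z : E), 0 ≤ S.indicator (fun z => ‖z‖ ^ s) z :=
    fun S s z => Set.indicator_nonneg (fun z _ => by positivity) z
  have hG₁0 : ∀ z, 0 ≤ G₁ z := fun z =>
    add_nonneg (mul_nonneg hC0 (hi _ _ _)) (mul_nonneg (by positivity) (hi _ _ _))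
  have hG₂0 : ∀ z, 0 ≤ G₂ z := fun z => mul_nonneg (by positivity) (hi _ _ _)
  refine ⟨∫ z, G₁ z ∂μ + ∫ z, G₂ z ∂μ, fun a ha haM r hr => ?_⟩
  set T : Set E := {z | r ≤ ‖z‖} with hT
  have hTm : MeasurableSet T := measurableSet_le measurable_const measurable_norm
  set f : E → ℝ := fun z => (‖a + z‖ ^ β - ‖a‖ ^ β) / ‖z‖ ^ p with hf
  let L : E → ℝ := (B ∩ T).indicator fun z =>
    β / 2 * (‖a‖ ^ 2) ^ (β / 2 - 1) * (2 * inner ℝ a z) / ‖z‖ ^ p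
  have hfm : Measurable f := by
    refine Measurable.div (Measurable.sub ?_ measurable_const) (measurable_norm.pow_const p)
    exact (measurable_const.add measurable_id).norm.pow_const β
  have hLm : Measurable L := by
    refine Measurable.indicator ?_ (measurableSet_ball.inter hTm)
    refine Measurable.div ?_ (measurable_norm.pow_const p)
    fun_prop
  have hp0 : 0 < p := lt_of_le_of_lt (Nat.cast_nonneg _) hp
  have hLi : Integrable L μ := by
    rw [integrable_indicator_iff (measurableSet_ball.inter hTm)]
    refine IntegrableOn.of_bound
      (C := |β / 2| * (‖a‖ ^ 2) ^ (β / 2 - 1) * (2 * (‖a‖ * R)) / r ^ p)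
      (lt_of_le_of_lt (measure_mono Set.inter_subset_left) measure_ball_lt_top)
      ?_ ?_
    · refine (Measurable.div ?_ (measurable_norm.pow_const p)).aestronglyMeasurable
      fun_prop
    · refine ae_restrict_of_forall_mem (measurableSet_ball.inter hTm) fun z hz => ?_
      have hz1 : ‖z‖ ≤ R := by simpa using (Metric.mem_ball.1 hz.1).le
      have hz2 : r ≤ ‖z‖ := hz.2
      have hr0 := hr.1
      have := abs_real_inner_le_norm a z
      rw [norm_div, norm_mul, norm_mul, norm_mul, Real.norm_eq_abs, Real.norm_eq_abs,
        Real.norm_eq_abs, Real.norm_eq_abs, Real.norm_eq_abs, abs_two,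
        abs_of_nonneg (Real.rpow_nonneg (sq_nonneg ‖a‖) _),
        abs_of_nonneg (Real.rpow_nonneg (norm_nonneg z) _)]
      gcongr
      exact this.trans (by gcongr)
  have hLT : ∫ z in T, L z ∂μ = 0 := by
    rw [setIntegral_eq_integral_of_forall_compl_eq_zero
      (fun z hz => Set.indicator_of_notMem (fun h => hz h.2) _)]
    refine integral_eq_zero_of_odd μ fun z => ?_
    have hmem : -z ∈ B ∩ T ↔ z ∈ B ∩ T := by simp [hB, hT]
    by_cases h : z ∈ B ∩ T
    · simp only [Set.indicator_of_mem h, Set.indicator_of_mem (hmem.2 h), inner_neg_right,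
        norm_neg]
      ring
    · simp only [Set.indicator_of_notMem h, Set.indicator_of_notMem (mt hmem.1 h), neg_zero]
  have hbound : ∀ z ∈ T, ‖f z - L z‖ ≤ G₁ z + G₂ (a + z) := by
    intro z hz
    have hrz : r ≤ ‖z‖ := hz
    have hz0 : 0 < ‖z‖ := hr.1.trans_le hrz
    by_cases hzB : z ∈ B
    · have hzR : ‖z‖ ≤ R := by simpa using (Metric.mem_ball.1 hzB).le
      refine le_trans ?_ (le_add_of_nonneg_right (hG₂0 _))
      have hzc : z ∉ Bᶜ := fun h => h hzB
      simp only [f, L, G₁, Set.indicator_of_mem hzB, Set.indicator_of_notMem hzc,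
        Set.indicator_of_mem (show z ∈ B ∩ T from ⟨hzB, hz⟩), mul_zero, add_zero]
      rw [← sub_div, norm_div, Real.norm_eq_abs, Real.norm_of_nonneg (by positivity),
        Real.rpow_sub hz0, Real.rpow_two, ← mul_div_assoc]
      gcongr
      exact abs_norm_add_rpow_sub_le hR hβ ha haM hzR
    · have hzR : R ≤ ‖z‖ := by simpa [hB] using hzB
      have hzc : z ∈ Bᶜ := hzB
      simp only [f, L, G₁, G₂, Set.indicator_of_notMem hzB, Set.indicator_of_mem hzc,
        Set.indicator_of_notMem (show z ∉ B ∩ T from fun h => hzB h.1), mul_zero, zero_add,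
        sub_zero]
      have h1 : ‖a‖ ^ β ≤ R ^ β :=
        Real.rpow_le_rpow_of_nonpos hR (by linarith) hβ.le
      have h2 : ‖a + z‖ ^ β ≤ R ^ β + B.indicator (fun z => ‖z‖ ^ β) (a + z) := by
        by_cases h : a + z ∈ B
        · rw [Set.indicator_of_mem h]
          exact le_add_of_nonneg_left (by positivity)
        · rw [Set.indicator_of_notMem h, add_zero]
          exact Real.rpow_le_rpow_of_nonpos hR (by simpa [hB] using h) hβ.le
      have h3 : |‖a + z‖ ^ β - ‖a‖ ^ β| ≤
          2 * R ^ β + B.indicator (fun z => ‖z‖ ^ β) (a + z) := by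
        have h4 : 0 ≤ ‖a‖ ^ β := by positivity
        have h5 : 0 ≤ ‖a + z‖ ^ β := by positivity
        rw [abs_le]
        constructor <;> linarith [hi B β (a + z)]
      rw [norm_div, Real.norm_eq_abs, Real.norm_of_nonneg (by positivity), div_eq_mul_inv,
        ← Real.rpow_neg hz0.le]
      calc _ ≤ (2 * R ^ β + B.indicator (fun z => ‖z‖ ^ β) (a + z)) * ‖z‖ ^ (-p) := by gcongr
        _ = 2 * R ^ β * ‖z‖ ^ (-p) + ‖z‖ ^ (-p) * B.indicator (fun z => ‖z‖ ^ β) (a + z) := by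
          ring
        _ ≤ _ := by
          have := mul_le_mul_of_nonneg_right
            (Real.rpow_le_rpow_of_nonpos hR hzR (by linarith : -p ≤ 0)) (hi B β (a + z))
          linarith
  have hGi : Integrable (fun z => G₁ z + G₂ (a + z)) μ := hG₁.add (hG₂.comp_add_left a)
  have hdi : IntegrableOn (fun z => f z - L z) T μ :=
    hGi.integrableOn.mono' (hfm.sub hLm).aestronglyMeasurable
      (ae_restrict_of_forall_mem hTm hbound)
  have hfeq : f = fun z => (f z - L z) + L z := by funext z; ring
  have hfi : IntegrableOn f T μ := by
    rw [hfeq]; exact hdi.add hLi.integrableOn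
  refine ⟨hfi, ?_⟩
  rw [hfeq, integral_add hdi hLi.integrableOn, hLT, add_zero, ← Real.norm_eq_abs]
  calc _ ≤ ∫ z in T, G₁ z + G₂ (a + z) ∂μ :=
        norm_integral_le_of_norm_le hGi.integrableOn (ae_restrict_of_forall_mem hTm hbound)
    _ ≤ ∫ z, G₁ z + G₂ (a + z) ∂μ :=
        setIntegral_le_integral hGi
          (Filter.Eventually.of_forall fun z => add_nonneg (hG₁0 z) (hG₂0 _))
    _ = _ := by
        rw [integral_add hG₁ (hG₂.comp_add_left a), integral_add_left_eq_self]

end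

/-- For `d ∈ {2,3}`, `α ∈ (1/2,1)`, a nonempty compact `Γ ⊆ ℝ^d` and a
point `x` with `dist(x,Γ) > 0`, setting `r* = dist(x,Γ)/2`, there is a constant `K̃`
(independent of `y` and `r`) such that for all `y ∈ Γ` and all `r ∈ (0, r*]`, the
truncated integral `∫_{|z| ≥ r} (|x+z-y|^{2α-d} - |x-y|^{2α-d}) / |z|^{d+2α} dz`
converges absolutely and is bounded by `K̃` in absolute value. -/
theorem stmt8
    (d : ℕ) (hd : d = 2 ∨ d = 3)
    (α : ℝ) (hα : α ∈ Set.Ioo (1/2 : ℝ) 1)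
    (Γ : Set (EuclideanSpace ℝ (Fin d))) (hΓc : IsCompact Γ) (hΓne : Γ.Nonempty)
    (x : EuclideanSpace ℝ (Fin d)) (hx : 0 < Metric.infDist x Γ) :
    ∃ K : ℝ, ∀ y ∈ Γ, ∀ r ∈ Set.Ioc (0 : ℝ) (Metric.infDist x Γ / 2),
      IntegrableOn
        (fun z : EuclideanSpace ℝ (Fin d) =>
          (‖x + z - y‖ ^ (2 * α - (d : ℝ)) - ‖x - y‖ ^ (2 * α - (d : ℝ))) /
            ‖z‖ ^ ((d : ℝ) + 2 * α))
        {z : EuclideanSpace ℝ (Fin d) | r ≤ ‖z‖} ∧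
      |∫ z in {z : EuclideanSpace ℝ (Fin d) | r ≤ ‖z‖},
          (‖x + z - y‖ ^ (2 * α - (d : ℝ)) - ‖x - y‖ ^ (2 * α - (d : ℝ))) /
            ‖z‖ ^ ((d : ℝ) + 2 * α)| ≤ K := by
  obtain ⟨M, hM⟩ := hΓc.isBounded.exists_norm_le
  have hfin : Module.finrank ℝ (EuclideanSpace ℝ (Fin d)) = d := finrank_euclideanSpace_fin
  have hd2 : 2 ≤ d := by omega
  have hd2' : (2 : ℝ) ≤ d := by exact_mod_cast hd2
  obtain ⟨hα1, hα2⟩ := hα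
  obtain ⟨K, hK⟩ := exists_bound_truncated_integral
    (volume : Measure (EuclideanSpace ℝ (Fin d))) (by rw [hfin]; omega)
    (β := 2 * α - d) (p := d + 2 * α) (R := Metric.infDist x Γ / 2) (M := ‖x‖ + M)
    (by linarith) (by rw [hfin]; linarith) (by rw [hfin]; linarith) (by rw [hfin]; linarith)
    (by linarith)
  refine ⟨K, fun y hy r hr => ?_⟩
  have key := hK (x - y) ?_ ?_ r hr
  · simpa only [sub_add_eq_add_sub] using key
  · rw [mul_div_cancel₀ _ two_ne_zero, ← dist_eq_norm]
    exact Metric.infDist_le_dist_of_mem hy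
  · exact (norm_sub_le x y).trans (by gcongr; exact hM y hy)
end
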